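/- Let ξ ∈ S be pure and let 0 ≤ k ≤ m. Then the linear span of the set {ρ(x₁) ∘ ρ(x₂) ∘ ⋯ ∘ ρ(x_k) (ξ) : x₁, …, x_k ∈ V} (with the convention that for k = 0 this set is {ξ}) is a subspace of S of dimension Σ_{j=0}^{k} C(m, j), where C(m, j) denotes the binomial coefficient. -/

import Mathlib

noncomputable section

open scoped TensorProduct

/-- The `(2m+1)`-dimensional space `V := N × N* × ℂ`. -/
abbrev Vsp (N : Type) [AddCommGroup N] [Module ℂ N] : Type := N × (N →ₗ[ℂ] ℂ) × ℂ

/-- The bilinear map `B((v,φ,t),(v',φ',t')) = φ(v') − t·t'`, whose diagonal is `Q`. -/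
def Bform (N : Type) [AddCommGroup N] [Module ℂ N] : Vsp N →ₗ[ℂ] Vsp N →ₗ[ℂ] ℂ :=
  LinearMap.mk₂ ℂ (fun x y => x.2.1 y.1 - x.2.2 * y.2.2)
    (fun x x' y => by simp only [Prod.fst_add, Prod.snd_add, LinearMap.add_apply]; ring)
    (fun c x y => by
      simp only [Prod.smul_fst, Prod.smul_snd, LinearMap.smul_apply, smul_eq_mul]; ring)
    (fun x y y' => by simp only [Prod.fst_add, Prod.snd_add, map_add]; ring)
    (fun c x y => by simp only [Prod.smul_fst, Prod.smul_snd, map_smul, smul_eq_mul]; ring)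

/-- The quadratic form `Q(v, φ, t) := φ(v) − t²`. -/
def Qform (N : Type) [AddCommGroup N] [Module ℂ N] : QuadraticForm ℂ (Vsp N) :=
  LinearMap.BilinMap.toQuadraticMap (Bform N)

/-- The polar form `g(x,y) := (Q(x+y) − Q(x) − Q(y))/2`. -/
def gform (N : Type) [AddCommGroup N] [Module ℂ N] (x y : Vsp N) : ℂ :=
  (Qform N (x + y) - Qform N x - Qform N y) / 2

/-- `σ` : the involution acting on `⋀^k N` as `(−1)^(m−k)`. -/
def sigmaMap (m : ℕ) (N : Type) [AddCommGroup N] [Module ℂ N] :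
    ExteriorAlgebra ℂ N →ₗ[ℂ] ExteriorAlgebra ℂ N :=
  ((-1 : ℂ) ^ m) • (CliffordAlgebra.involute (Q := (0 : QuadraticForm ℂ N))).toLinearMap

/-- `ρ(v, φ, t)(ξ) := v ∧ ξ − ι_φ(ξ) + t·σ(ξ)`. -/
def rho (m : ℕ) (N : Type) [AddCommGroup N] [Module ℂ N] :
    Vsp N →ₗ[ℂ] ExteriorAlgebra ℂ N →ₗ[ℂ] ExteriorAlgebra ℂ N :=
  (LinearMap.mul ℂ (ExteriorAlgebra ℂ N) ∘ₗ ExteriorAlgebra.ι ℂ ∘ₗ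
      LinearMap.fst ℂ N ((N →ₗ[ℂ] ℂ) × ℂ))
  - (CliffordAlgebra.contractLeft (Q := (0 : QuadraticForm ℂ N)) ∘ₗ
      LinearMap.fst ℂ (N →ₗ[ℂ] ℂ) ℂ ∘ₗ LinearMap.snd ℂ N ((N →ₗ[ℂ] ℂ) × ℂ))
  + (LinearMap.toSpanSingleton ℂ (ExteriorAlgebra ℂ N →ₗ[ℂ] ExteriorAlgebra ℂ N)
        (sigmaMap m N) ∘ₗ
      LinearMap.snd ℂ (N →ₗ[ℂ] ℂ) ℂ ∘ₗ LinearMap.snd ℂ N ((N →ₗ[ℂ] ℂ) × ℂ))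

/-- `K_ξ := {x ∈ V : ρ(x)(ξ) = 0}`. -/
def Kker (m : ℕ) (N : Type) [AddCommGroup N] [Module ℂ N] (ξ : ExteriorAlgebra ℂ N) :
    Submodule ℂ (Vsp N) :=
  LinearMap.ker ((rho m N).flip ξ)

section CliffordFiltration

variable {F V S : Type*} [Field F] [AddCommGroup V] [Module F V] [AddCommGroup S] [Module F S]

/-- The span of the products `ρ(b i₁) ⋯ ρ(b i_j)` applied to `P`, where `j ≤ k` and
`n > i₁ > ⋯ > i_j`. -/
def cliffordFiltration (ρ : V →ₗ[F] S →ₗ[F] S) (b : ℕ → V) (P : Submodule F S) :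
    ℕ → ℕ → Submodule F S
  | 0, _ => P
  | _ + 1, 0 => P
  | n + 1, k + 1 =>
    cliffordFiltration ρ b P n (k + 1) ⊔ (cliffordFiltration ρ b P n k).map (ρ (b n))

variable {ρ : V →ₗ[F] S →ₗ[F] S} {b : ℕ → V} {P : Submodule F S}

lemma cliffordFiltration_zero_right (n : ℕ) : cliffordFiltration ρ b P n 0 = P := by
  cases n <;> simp [cliffordFiltration]

lemma cliffordFiltration_le_succ_left (n k : ℕ) :
    cliffordFiltration ρ b P n k ≤ cliffordFiltration ρ b P (n + 1) k := by
  cases k with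
  | zero => simp [cliffordFiltration_zero_right]
  | succ k => exact le_sup_left

lemma map_mem_cliffordFiltration_succ {n k : ℕ} {s : S} (hs : s ∈ cliffordFiltration ρ b P n k) :
    ρ (b n) s ∈ cliffordFiltration ρ b P (n + 1) (k + 1) :=
  Submodule.mem_sup_right (Submodule.mem_map_of_mem hs)

lemma cliffordFiltration_le_succ_right (n k : ℕ) :
    cliffordFiltration ρ b P n k ≤ cliffordFiltration ρ b P n (k + 1) := by
  induction n generalizing k with
  | zero => simp [cliffordFiltration]
  | succ n ih =>
    cases k with
    | zero =>
      refine le_trans (le_of_eq ?_) ((ih 0).trans (cliffordFiltration_le_succ_left n _))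
      rw [cliffordFiltration_zero_right, cliffordFiltration_zero_right]
    | succ k => exact sup_le_sup (ih _) (Submodule.map_mono (ih _))

lemma cliffordFiltration_le {G : ℕ → Submodule F S} (hG : Monotone G) (hP : P ≤ G 0)
    (hρ : ∀ k x, ∀ s ∈ G k, ρ x s ∈ G (k + 1)) (n k : ℕ) :
    cliffordFiltration ρ b P n k ≤ G k := by
  induction n generalizing k with
  | zero => exact hP.trans (hG (Nat.zero_le k))
  | succ n ih =>
    cases k with
    | zero => exact hP
    | succ k => exact sup_le (ih _) (Submodule.map_le_iff_le_comap.2 fun s hs => hρ _ _ _ (ih _ hs))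

variable {β : V →ₗ[F] V →ₗ[F] F}

lemma map_mem_cliffordFiltration_of_map_mem
    (hρ : ∀ x y s, ρ x (ρ y s) + ρ y (ρ x s) = β x y • s) {x : V}
    (hx : ∀ s ∈ P, ρ x s ∈ P) (n k : ℕ) :
    ∀ s ∈ cliffordFiltration ρ b P n k, ρ x s ∈ cliffordFiltration ρ b P n k := by
  induction n generalizing k with
  | zero => exact hx
  | succ n ih =>
    cases k with
    | zero => exact hx
    | succ k =>
      intro s hs
      obtain ⟨y, hy, _, ⟨z, hz, rfl⟩, rfl⟩ := Submodule.mem_sup.1 hs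
      rw [map_add, eq_sub_of_add_eq (hρ x (b n) z)]
      refine add_mem (cliffordFiltration_le_succ_left _ _ (ih _ _ hy)) (sub_mem ?_ ?_)
      · exact Submodule.smul_mem _ _
          (cliffordFiltration_le_succ_left _ _ (cliffordFiltration_le_succ_right _ _ hz))
      · exact map_mem_cliffordFiltration_succ (ih _ _ hz)

lemma map_mem_cliffordFiltration_of_lt
    (hρ : ∀ x y s, ρ x (ρ y s) + ρ y (ρ x s) = β x y • s) [NeZero (2 : F)] {i n : ℕ}
    (hi : i < n) (k : ℕ) :
    ∀ s ∈ cliffordFiltration ρ b P n k, ρ (b i) s ∈ cliffordFiltration ρ b P n (k + 1) := by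
  induction n generalizing k with
  | zero => omega
  | succ n ih =>
    rcases Nat.lt_succ_iff_lt_or_eq.1 hi with hin | rfl
    · cases k with
      | zero =>
        intro s hs
        rw [cliffordFiltration_zero_right,
          ← cliffordFiltration_zero_right (ρ := ρ) (b := b) (P := P) n] at hs
        exact cliffordFiltration_le_succ_left _ _ (ih hin 0 s hs)
      | succ k =>
        intro s hs
        obtain ⟨y, hy, _, ⟨z, hz, rfl⟩, rfl⟩ := Submodule.mem_sup.1 hs
        rw [map_add, eq_sub_of_add_eq (hρ (b i) (b n) z)]
        refine add_mem (cliffordFiltration_le_succ_left _ _ (ih hin _ _ hy)) (sub_mem ?_ ?_)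
        · exact Submodule.smul_mem _ _ (cliffordFiltration_le_succ_left _ _
            (cliffordFiltration_le_succ_right _ _ (cliffordFiltration_le_succ_right _ _ hz)))
        · exact map_mem_cliffordFiltration_succ (ih hin _ _ hz)
    · cases k with
      | zero =>
        intro s hs
        rw [cliffordFiltration_zero_right,
          ← cliffordFiltration_zero_right (ρ := ρ) (b := b) (P := P) i] at hs
        exact map_mem_cliffordFiltration_succ hs
      | succ k =>
        intro s hs
        obtain ⟨y, hy, _, ⟨z, hz, rfl⟩, rfl⟩ := Submodule.mem_sup.1 hs
        have hsq : ρ (b i) (ρ (b i) z) = ((2 : F)⁻¹ * β (b i) (b i)) • z := by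
          rw [mul_smul, ← hρ, ← two_smul F, inv_smul_smul₀ two_ne_zero]
        rw [map_add, hsq]
        refine add_mem (map_mem_cliffordFiltration_succ hy) (Submodule.smul_mem _ _ ?_)
        exact cliffordFiltration_le_succ_left _ _
          (cliffordFiltration_le_succ_right _ _ (cliffordFiltration_le_succ_right _ _ hz))

lemma map_cliffordFiltration_eq_zero
    (hρ : ∀ x y s, ρ x (ρ y s) + ρ y (ρ x s) = β x y • s) {x : V} (hx : ∀ s ∈ P, ρ x s = 0)
    {n : ℕ} (hxb : ∀ i < n, β x (b i) = 0) (k : ℕ) :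
    ∀ s ∈ cliffordFiltration ρ b P n k, ρ x s = 0 := by
  induction n generalizing k with
  | zero => exact hx
  | succ n ih =>
    have ih := ih fun i hi => hxb i (by omega)
    cases k with
    | zero => exact hx
    | succ k =>
      intro s hs
      obtain ⟨y, hy, _, ⟨z, hz, rfl⟩, rfl⟩ := Submodule.mem_sup.1 hs
      rw [map_add, eq_sub_of_add_eq (hρ x (b n) z), ih _ _ hy, ih _ _ hz, hxb n (by omega)]
      simp

lemma sum_range_choose_succ (n k : ℕ) :
    ∑ j ∈ Finset.range (k + 2), (n + 1).choose j =
      ∑ j ∈ Finset.range (k + 2), n.choose j + ∑ j ∈ Finset.range (k + 1), n.choose j := by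
  rw [Finset.sum_range_succ', Finset.sum_range_succ' _ (k + 1)]
  simp only [Nat.choose_succ_succ, Finset.sum_add_distrib, Nat.choose_zero_right]
  ring

lemma finrank_cliffordFiltration [FiniteDimensional F S]
    (hρ : ∀ x y s, ρ x (ρ y s) + ρ y (ρ x s) = β x y • s) {a : ℕ → V} {n : ℕ}
    (ha : ∀ i < n, ∀ s ∈ P, ρ (a i) s = 0) (hab : ∀ i < n, β (a i) (b i) = 1)
    (hab' : ∀ i < n, ∀ j < i, β (a i) (b j) = 0) (k : ℕ) :
    Module.finrank F (cliffordFiltration ρ b P n k) =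
      (∑ j ∈ Finset.range (k + 1), n.choose j) * Module.finrank F P := by
  induction n generalizing k with
  | zero =>
    rw [show cliffordFiltration ρ b P 0 k = P by rw [cliffordFiltration]]
    simp [Finset.sum_range_succ']
  | succ n ih =>
    have ih := ih (fun i hi => ha i (by omega)) (fun i hi => hab i (by omega))
      (fun i hi => hab' i (by omega))
    cases k with
    | zero => rw [cliffordFiltration_zero_right]; simp
    | succ k =>
      have hzero := map_cliffordFiltration_eq_zero hρ (ha n (by omega)) (hab' n (by omega))
      have hinv : ∀ z ∈ cliffordFiltration ρ b P n k, ρ (a n) (ρ (b n) z) = z := fun z hz => by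
        rw [eq_sub_of_add_eq (hρ (a n) (b n) z), hzero _ _ hz, hab n (by omega)]
        simp
      have hdisj : Disjoint (cliffordFiltration ρ b P n (k + 1))
          ((cliffordFiltration ρ b P n k).map (ρ (b n))) := by
        rw [Submodule.disjoint_def]
        rintro _ hy ⟨z, hz, rfl⟩
        rw [← hinv z hz, hzero _ _ hy, map_zero]
      have hmap : Module.finrank F ((cliffordFiltration ρ b P n k).map (ρ (b n))) =
          Module.finrank F (cliffordFiltration ρ b P n k) := by
        rw [← LinearMap.range_domRestrict]
        refine LinearMap.finrank_range_of_inj fun y z h => Subtype.ext ?_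
        rw [← hinv y y.2, ← hinv z z.2]
        exact congrArg (ρ (a n)) h
      have hsum := Submodule.finrank_sup_add_finrank_inf_eq (cliffordFiltration ρ b P n (k + 1))
        ((cliffordFiltration ρ b P n k).map (ρ (b n)))
      rw [hdisj.eq_bot, finrank_bot, add_zero, hmap, ih, ih, ← add_mul] at hsum
      rw [sum_range_choose_succ]
      exact hsum

end CliffordFiltration

section Spinors

variable {N : Type} [AddCommGroup N] [Module ℂ N]

/-- The symmetric bilinear form `-2g`. -/
def cliffordForm (N : Type) [AddCommGroup N] [Module ℂ N] : Vsp N →ₗ[ℂ] Vsp N →ₗ[ℂ] ℂ :=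
  -(Bform N + (Bform N).flip)

lemma cliffordForm_apply (x y : Vsp N) :
    cliffordForm N x y = 2 * (x.2.2 * y.2.2) - x.2.1 y.1 - y.2.1 x.1 := by
  simp only [cliffordForm, Bform, LinearMap.neg_apply, LinearMap.add_apply, LinearMap.flip_apply,
    LinearMap.mk₂_apply]
  ring

lemma cliffordForm_injective [FiniteDimensional ℂ N] : Function.Injective (cliffordForm N) := by
  rw [← LinearMap.ker_eq_bot, LinearMap.ker_eq_bot']
  rintro ⟨v, φ, t⟩ h
  have hx (y : Vsp N) : cliffordForm N (v, φ, t) y = 0 := by rw [h, LinearMap.zero_apply]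
  simp only [cliffordForm_apply] at hx
  have ht : t = 0 := by simpa using hx (0, 0, 1)
  have hφ : φ = 0 := LinearMap.ext fun w => by simpa using hx (w, 0, 0)
  have hv : v = 0 := (Module.forall_dual_apply_eq_zero_iff ℂ v).1 fun ψ => by
    simpa using hx (0, ψ, 0)
  rw [ht, hφ, hv]
  rfl

lemma contractLeft_involute (φ : N →ₗ[ℂ] ℂ) (s : ExteriorAlgebra ℂ N) :
    CliffordAlgebra.contractLeft (Q := (0 : QuadraticForm ℂ N)) φ (CliffordAlgebra.involute s) =
      -CliffordAlgebra.involute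
        (CliffordAlgebra.contractLeft (Q := (0 : QuadraticForm ℂ N)) φ s) := by
  induction s using CliffordAlgebra.left_induction with
  | algebraMap r => simp
  | add x y hx hy => rw [map_add, map_add, hx, hy, map_add, map_add, neg_add]
  | ι_mul x v hx =>
    rw [map_mul, CliffordAlgebra.involute_ι, neg_mul, map_neg, CliffordAlgebra.contractLeft_ι_mul,
      CliffordAlgebra.contractLeft_ι_mul, hx, map_sub, map_mul, CliffordAlgebra.involute_ι, map_smul]
    simp

lemma rho_apply (m : ℕ) (x : Vsp N) (s : ExteriorAlgebra ℂ N) :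
    rho m N x s = CliffordAlgebra.ι (0 : QuadraticForm ℂ N) x.1 * s -
      CliffordAlgebra.contractLeft (Q := (0 : QuadraticForm ℂ N)) x.2.1 s +
      (x.2.2 * (-1) ^ m) • CliffordAlgebra.involute s := by
  rw [mul_smul]
  rfl

lemma rho_rho_add_rho_rho (m : ℕ) (x y : Vsp N) (s : ExteriorAlgebra ℂ N) :
    rho m N x (rho m N y s) + rho m N y (rho m N x s) = cliffordForm N x y • s := by
  have hxy : CliffordAlgebra.ι (0 : QuadraticForm ℂ N) x.1 *
      (CliffordAlgebra.ι (0 : QuadraticForm ℂ N) y.1 * s) =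
      -(CliffordAlgebra.ι (0 : QuadraticForm ℂ N) y.1 *
      (CliffordAlgebra.ι (0 : QuadraticForm ℂ N) x.1 * s)) := by
    have h : CliffordAlgebra.ι (0 : QuadraticForm ℂ N) x.1 * CliffordAlgebra.ι 0 y.1 =
        -(CliffordAlgebra.ι (0 : QuadraticForm ℂ N) y.1 * CliffordAlgebra.ι 0 x.1) :=
      eq_neg_of_add_eq_zero_left (ExteriorAlgebra.ι_add_mul_swap x.1 y.1)
    rw [← mul_assoc, h, neg_mul, mul_assoc]
  have hm : ((-1 : ℂ) ^ m) * (-1) ^ m = 1 := by rw [← mul_pow]; simp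
  have ht : x.2.2 * (-1) ^ m * (y.2.2 * (-1) ^ m) = x.2.2 * y.2.2 := by
    linear_combination (x.2.2 * y.2.2) * hm
  have ht' : y.2.2 * (-1) ^ m * (x.2.2 * (-1) ^ m) = x.2.2 * y.2.2 := by
    linear_combination (x.2.2 * y.2.2) * hm
  simp only [rho_apply, map_add, map_sub, map_smul, map_mul,
    CliffordAlgebra.involute_ι, CliffordAlgebra.contractLeft_ι_mul, contractLeft_involute,
    CliffordAlgebra.involute_involute, smul_add, smul_sub, smul_smul, ht, ht', hxy,
    CliffordAlgebra.contractLeft_comm x.2.1 y.2.1, cliffordForm_apply,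
    neg_mul, smul_neg]
  module

lemma finrank_exteriorAlgebra [FiniteDimensional ℂ N] :
    Module.finrank ℂ (ExteriorAlgebra ℂ N) = 2 ^ Module.finrank ℂ N := by
  simp [Module.finrank_eq_card_basis (Module.finBasis ℂ N).ExteriorAlgebra]

instance [FiniteDimensional ℂ N] : FiniteDimensional ℂ (ExteriorAlgebra ℂ N) :=
  (Module.finBasis ℂ N).ExteriorAlgebra.finiteDimensional_of_finite

lemma finrank_Vsp [FiniteDimensional ℂ N] :
    Module.finrank ℂ (Vsp N) = 2 * Module.finrank ℂ N + 1 := by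
  rw [Module.finrank_prod, Module.finrank_prod, Module.finrank_self]
  have h : Module.finrank ℂ (N →ₗ[ℂ] ℂ) = Module.finrank ℂ N := Subspace.dual_finrank_eq
  omega

lemma foldr_rho_smul (m : ℕ) (c : ℂ) (s : ExteriorAlgebra ℂ N) (l : List (Vsp N)) :
    l.foldr (fun x acc => rho m N x acc) (c • s) =
      c • l.foldr (fun x acc => rho m N x acc) s := by
  induction l with
  | nil => rfl
  | cons x l ih => rw [List.foldr_cons, ih, map_smul, List.foldr_cons]

lemma mem_Kker {m : ℕ} {ξ : ExteriorAlgebra ℂ N} {x : Vsp N} :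
    x ∈ Kker m N ξ ↔ rho m N x ξ = 0 := Iff.rfl

lemma cliffordForm_eq_zero_of_mem_Kker {m : ℕ} {ξ : ExteriorAlgebra ℂ N} (hξ0 : ξ ≠ 0)
    {x y : Vsp N} (hx : x ∈ Kker m N ξ) (hy : y ∈ Kker m N ξ) : cliffordForm N x y = 0 := by
  have h := rho_rho_add_rho_rho m x y ξ
  rw [mem_Kker.1 hx, mem_Kker.1 hy, map_zero, map_zero, add_zero] at h
  exact (smul_eq_zero.1 h.symm).resolve_right hξ0

/-- The form `-2g` as a pairing of `V` with the subspace `K`. -/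
def pairingWith (K : Submodule ℂ (Vsp N)) : Vsp N →ₗ[ℂ] Module.Dual ℂ K :=
  (cliffordForm N ∘ₗ K.subtype).flip

lemma pairingWith_apply (K : Submodule ℂ (Vsp N)) (x : Vsp N) (y : K) :
    pairingWith K x y = cliffordForm N y x := rfl

lemma pairingWith_surjective [FiniteDimensional ℂ N] (K : Submodule ℂ (Vsp N)) :
    Function.Surjective (pairingWith K) :=
  LinearMap.flip_surjective_iff₁.2 (cliffordForm_injective.comp K.injective_subtype)

/-- The orthogonal complement of `K_ξ` is spanned by `K_ξ` and one further vector. -/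
lemma exists_ker_pairingWith_Kker_eq [FiniteDimensional ℂ N] {ξ : ExteriorAlgebra ℂ N}
    (hξ0 : ξ ≠ 0) {m : ℕ} (hdim : Module.finrank ℂ N = m)
    (hξ : Module.finrank ℂ (Kker m N ξ) = m) :
    ∃ e ∉ Kker m N ξ, LinearMap.ker (pairingWith (Kker m N ξ)) = Kker m N ξ ⊔ ℂ ∙ e := by
  set K := Kker m N ξ
  have hle : K ≤ LinearMap.ker (pairingWith K) := fun x hx =>
    LinearMap.ext fun y => cliffordForm_eq_zero_of_mem_Kker hξ0 y.2 hx
  have hker : Module.finrank ℂ (LinearMap.ker (pairingWith K)) = m + 1 := by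
    have h := LinearMap.finrank_range_add_finrank_ker (pairingWith K)
    rw [LinearMap.range_eq_top.2 (pairingWith_surjective K), finrank_top,
      Subspace.dual_finrank_eq, finrank_Vsp] at h
    omega
  obtain ⟨e, he, heK⟩ : ∃ e ∈ LinearMap.ker (pairingWith K), e ∉ K := by
    by_contra! h
    have := Submodule.finrank_mono (show LinearMap.ker (pairingWith K) ≤ K from h)
    omega
  refine ⟨e, heK, (Submodule.eq_of_le_of_finrank_le ?_ ?_).symm⟩
  · exact sup_le hle ((Submodule.span_singleton_le_iff_mem _ _).2 he)
  · have hlt : K < K ⊔ ℂ ∙ e :=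
      lt_of_le_of_ne le_sup_left fun h => heK <| by
        rw [h]; exact Submodule.mem_sup_right (Submodule.mem_span_singleton_self e)
    have := Submodule.finrank_lt_finrank_of_lt hlt
    omega

/-- The vectors of `S` annihilated by a subspace `K` of `V`. -/
def annihilatedBy (m : ℕ) (K : Submodule ℂ (Vsp N)) : Submodule ℂ (ExteriorAlgebra ℂ N) :=
  ⨅ x : K, LinearMap.ker (rho m N x)

lemma mem_annihilatedBy {m : ℕ} {K : Submodule ℂ (Vsp N)} {s : ExteriorAlgebra ℂ N} :
    s ∈ annihilatedBy m K ↔ ∀ x ∈ K, rho m N x s = 0 := by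
  simp [annihilatedBy]

lemma exists_dual_families [FiniteDimensional ℂ N] {m : ℕ} (K : Submodule ℂ (Vsp N))
    (hK : Module.finrank ℂ K = m) :
    ∃ a b : ℕ → Vsp N, (∀ i, a i ∈ K) ∧ (∀ i < m, cliffordForm N (a i) (b i) = 1) ∧
      (∀ i < m, ∀ j < i, cliffordForm N (a i) (b j) = 0) ∧
      LinearMap.ker (pairingWith K) ⊔ Submodule.span ℂ (b '' Set.Iio m) = ⊤ := by
  let B := Module.finBasisOfFinrankEq ℂ K hK
  choose b hb using fun i => pairingWith_surjective K (B.coord i)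
  have hpair (i j : Fin m) : cliffordForm N (B i) (b j) = if i = j then 1 else 0 := by
    rw [← pairingWith_apply, hb, B.coord_apply, B.repr_self, Finsupp.single_apply]
  refine ⟨fun i => if h : i < m then B ⟨i, h⟩ else 0, fun i => if h : i < m then b ⟨i, h⟩ else 0,
    fun i => ?_, fun i hi => ?_, fun i hi j hj => ?_, ?_⟩
  · dsimp only
    split_ifs
    exacts [(B _).2, K.zero_mem]
  · simp [hi, hpair]
  · simp [hi, hj.trans hi, hpair, hj.ne']
  · rw [eq_top_iff]
    intro x _
    rw [← sub_add_cancel x (∑ i, pairingWith K x (B i) • b i)]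
    refine Submodule.add_mem_sup ?_ (Submodule.sum_mem _ fun i _ => Submodule.smul_mem _ _
      (Submodule.subset_span ⟨i, i.2, by simp⟩))
    rw [LinearMap.mem_ker, map_sub, sub_eq_zero]
    refine B.ext fun j => ?_
    simp [hb]

lemma finrank_annihilatedBy_le_one [FiniteDimensional ℂ N] {m : ℕ} {K : Submodule ℂ (Vsp N)}
    (hdim : Module.finrank ℂ N = m) (hK : Module.finrank ℂ K = m) :
    Module.finrank ℂ (annihilatedBy m K) ≤ 1 := by
  obtain ⟨a, b, haK, hab, hab', -⟩ := exists_dual_families K hK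
  have h := finrank_cliffordFiltration (P := annihilatedBy m K) (rho_rho_add_rho_rho m)
    (fun i _ s hs => mem_annihilatedBy.1 hs _ (haK i)) hab hab' m
  have hle := Submodule.finrank_le (cliffordFiltration (rho m N) b (annihilatedBy m K) m m)
  rw [h, Nat.sum_range_choose, finrank_exteriorAlgebra, hdim] at hle
  exact Nat.le_of_mul_le_mul_left (by simpa using hle) (pow_pos two_pos m)

/-- The span of the `k`-fold products `ρ(x₁) ⋯ ρ(x_k) ξ`. -/
def iteratedImage (m : ℕ) (ξ : ExteriorAlgebra ℂ N) (k : ℕ) :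
    Submodule ℂ (ExteriorAlgebra ℂ N) :=
  Submodule.span ℂ {η : ExteriorAlgebra ℂ N | ∃ l : List (Vsp N),
    l.length = k ∧ η = l.foldr (fun x acc => rho m N x acc) ξ}

lemma rho_mem_iteratedImage {m : ℕ} {ξ : ExteriorAlgebra ℂ N} (k : ℕ) (x : Vsp N) :
    ∀ s ∈ iteratedImage m ξ k, rho m N x s ∈ iteratedImage m ξ (k + 1) := by
  change iteratedImage m ξ k ≤ (iteratedImage m ξ (k + 1)).comap (rho m N x)
  refine Submodule.span_le.2 ?_
  rintro _ ⟨l, hl, rfl⟩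
  exact Submodule.subset_span ⟨x :: l, by simp [hl], rfl⟩

lemma iteratedImage_mono {m : ℕ} {ξ : ExteriorAlgebra ℂ N} {e : Vsp N} {c : ℂ} (hc : c ≠ 0)
    (he : rho m N e ξ = c • ξ) : Monotone (iteratedImage m ξ) := by
  refine monotone_nat_of_le_succ fun k => Submodule.span_le.2 ?_
  rintro _ ⟨l, hl, rfl⟩
  rw [← inv_smul_smul₀ hc (l.foldr _ ξ), ← foldr_rho_smul, ← he]
  exact Submodule.smul_mem _ _ (Submodule.subset_span ⟨l ++ [e], by simp [hl], by simp⟩)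

lemma iteratedImage_le {m : ℕ} {ξ : ExteriorAlgebra ℂ N}
    {G : ℕ → Submodule ℂ (ExteriorAlgebra ℂ N)} (hξ : ξ ∈ G 0)
    (hG : ∀ k x, ∀ s ∈ G k, rho m N x s ∈ G (k + 1)) (k : ℕ) : iteratedImage m ξ k ≤ G k := by
  refine Submodule.span_le.2 ?_
  rintro _ ⟨l, rfl, rfl⟩
  induction l with
  | nil => exact hξ
  | cons x l ih => exact hG _ _ _ ih

end Spinors

/-- for a pure spinor `ξ` and `0 ≤ k ≤ m`, the span of all spinors
`ρ(x₁) ∘ ⋯ ∘ ρ(x_k) (ξ)` has dimension `Σ_{j=0}^{k} C(m, j)`. -/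
theorem iterated_image_dimension
    (m : ℕ) (hm : 0 < m) (N : Type) [AddCommGroup N] [Module ℂ N]
    [FiniteDimensional ℂ N] (hdim : Module.finrank ℂ N = m)
    (ξ : ExteriorAlgebra ℂ N) (hξ0 : ξ ≠ 0)
    (hξ : Module.finrank ℂ (Kker m N ξ) = m)
    (k : ℕ) (hk : k ≤ m) :
    Module.finrank ℂ
        (Submodule.span ℂ
          {η : ExteriorAlgebra ℂ N | ∃ l : List (Vsp N),
            l.length = k ∧ η = l.foldr (fun x acc => rho m N x acc) ξ}) =
      ∑ j ∈ Finset.range (k + 1), Nat.choose m j := by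
  change Module.finrank ℂ (iteratedImage m ξ k) = _
  obtain ⟨e, heK, hker⟩ := exists_ker_pairingWith_Kker_eq hξ0 hdim hξ
  obtain ⟨a, b, haK, hab, hab', htop⟩ := exists_dual_families (Kker m N ξ) hξ
  have hρ := rho_rho_add_rho_rho (N := N) m
  have hmem : ξ ∈ annihilatedBy m (Kker m N ξ) := mem_annihilatedBy.2 fun x hx => hx
  have hann : annihilatedBy m (Kker m N ξ) = ℂ ∙ ξ := by
    refine (Submodule.eq_of_le_of_finrank_le
      ((Submodule.span_singleton_le_iff_mem _ _).2 hmem) ?_).symm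
    rw [finrank_span_singleton hξ0]
    exact finrank_annihilatedBy_le_one hdim hξ
  obtain ⟨c, hc⟩ : ∃ c : ℂ, c • ξ = rho m N e ξ := by
    rw [← Submodule.mem_span_singleton, ← hann, mem_annihilatedBy]
    intro x hx
    have he : e ∈ LinearMap.ker (pairingWith (Kker m N ξ)) :=
      hker ▸ Submodule.mem_sup_right (Submodule.mem_span_singleton_self e)
    have hxe : cliffordForm N x e = 0 := LinearMap.congr_fun he ⟨x, hx⟩
    rw [eq_sub_of_add_eq (hρ x e ξ), hxe, mem_Kker.1 hx]
    simp
  have hc0 : c ≠ 0 := by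
    rintro rfl
    exact heK (mem_Kker.2 (by rw [← hc, zero_smul]))
  have hKP : ∀ x ∈ Kker m N ξ, ∀ s ∈ ℂ ∙ ξ, rho m N x s = 0 := by
    rw [← hann]
    exact fun x hx s hs => mem_annihilatedBy.1 hs x hx
  have heP : ∀ s ∈ ℂ ∙ ξ, rho m N e s ∈ ℂ ∙ ξ := by
    intro s hs
    obtain ⟨d, rfl⟩ := Submodule.mem_span_singleton.1 hs
    rw [map_smul, ← hc]
    exact Submodule.smul_mem _ _ (Submodule.smul_mem _ _ (Submodule.mem_span_singleton_self ξ))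
  have hstep : ∀ k x, ∀ s ∈ cliffordFiltration (rho m N) b (ℂ ∙ ξ) m k,
      rho m N x s ∈ cliffordFiltration (rho m N) b (ℂ ∙ ξ) m (k + 1) := by
    intro k x s hs
    let X := (cliffordFiltration (rho m N) b (ℂ ∙ ξ) m (k + 1)).comap ((rho m N).flip s)
    suffices h : (⊤ : Submodule ℂ (Vsp N)) ≤ X from h (Submodule.mem_top (x := x))
    rw [← htop, hker]
    refine sup_le (sup_le (fun y hy => ?_) ((Submodule.span_singleton_le_iff_mem _ _).2 ?_))
      (Submodule.span_le.2 ?_)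
    · refine cliffordFiltration_le_succ_right _ _
        (map_mem_cliffordFiltration_of_map_mem hρ (fun s hs => ?_) _ _ _ hs)
      rw [hKP y hy s hs]
      exact Submodule.zero_mem _
    · exact cliffordFiltration_le_succ_right _ _
        (map_mem_cliffordFiltration_of_map_mem hρ heP _ _ _ hs)
    · rintro _ ⟨i, hi, rfl⟩
      exact map_mem_cliffordFiltration_of_lt hρ hi _ _ hs
  have heq : iteratedImage m ξ k = cliffordFiltration (rho m N) b (ℂ ∙ ξ) m k := by
    refine le_antisymm (iteratedImage_le ?_ hstep k)
      (cliffordFiltration_le (iteratedImage_mono hc0 hc.symm) ?_ rho_mem_iteratedImage m k)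
    · rw [cliffordFiltration_zero_right]
      exact Submodule.mem_span_singleton_self ξ
    · exact (Submodule.span_singleton_le_iff_mem _ _).2 (Submodule.subset_span ⟨[], rfl, rfl⟩)
  rw [heq, finrank_cliffordFiltration hρ (fun i _ => hKP _ (haK i)) hab hab',
    finrank_span_singleton hξ0, mul_one]
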